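/- Let C be a binary linear [n,k,d_C] code with ⟨j_n⟩ ⊊ C and D a binary linear [m,l,d_D] code with ⟨j_m⟩ ⊊ D. Let C′ ⊂ C be a linear subcode of dimension k−1 containing ⟨j_n⟩, D′ ⊂ D a linear subcode of dimension l−1 containing ⟨j_m⟩, u ∈ C \ C′, and v ∈ D \ D′. Then every matrix N in the affine product code (C′+u)⊗(D′+v) of Construction I satisfies: (i) every row of N has Hamming weight at least d_C and at most n−d_C; (ii) every column of N has Hamming weight at least d_D and at most m−d_D. Moreover (C′+u)⊗(D′+v) is a subset of the product code C⊗D and is systematic of dimension (k−1)(l−1). -/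

import Mathlib

open Matrix

/-- The binary linear code with systematic encoder `(I_k | A)`, of length `n = k + r`. -/
def sysCode {F : Type*} [Field F] {k r : ℕ} (A : Matrix (Fin k) (Fin r) F) :
    Set ((Fin k ⊕ Fin r) → F) :=
  { c | ∃ x : Fin k → F, c = Sum.elim x (Matrix.vecMul x A) }

/-- The classical product code `C′ ⊗ D′`: matrices `((M, MA), (BᵀM, BᵀMA))`. -/
def prodCode {F : Type*} [Field F] {k r l s : ℕ} (A : Matrix (Fin k) (Fin r) F)
    (B : Matrix (Fin l) (Fin s) F) :
    Set (Matrix (Fin l ⊕ Fin s) (Fin k ⊕ Fin r) F) :=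
  { N | ∃ M : Matrix (Fin l) (Fin k) F,
      N = Matrix.fromBlocks M (M * A) (B.transpose * M) (B.transpose * M * A) }

/-- The translation matrix `U` of Construction I for `u = (0_k, a)`, `v = (0_l, b)`. -/
def consIU {F : Type*} [Field F] {k r l s : ℕ} (a : Fin r → F) (b : Fin s → F) :
    Matrix (Fin l ⊕ Fin s) (Fin k ⊕ Fin r) F :=
  Matrix.fromBlocks (0 : Matrix (Fin l) (Fin k) F)
    (Matrix.vecMulVec (fun _ : Fin l => (1 : F)) a)
    (Matrix.vecMulVec b (fun _ : Fin k => (1 : F)))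
    (Matrix.vecMulVec b (fun _ : Fin r => (1 : F))
      + Matrix.vecMulVec (fun _ : Fin s => (1 : F)) a)

/-- A matrix code `S` of size `q^K` is systematic of dimension `K` if there are `K`
coordinates such that the restriction of `S` to these coordinates is all of `F^K`. -/
def SystematicOfDim {α β F : Type*} [Fintype α] [Fintype β] [Fintype F]
    (S : Set (Matrix α β F)) (K : ℕ) : Prop :=
  S.ncard = Fintype.card F ^ K ∧
    ∃ coords : Finset (α × β), coords.card = K ∧
      ∀ f : α × β → F, ∃ N ∈ S, ∀ p ∈ coords, N p.1 p.2 = f p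

theorem one_vecMul_of_one_mem_sysCode {F : Type*} [Field F] {k r : ℕ}
    {A : Matrix (Fin k) (Fin r) F} (h : (fun _ => (1 : F)) ∈ sysCode A) :
    Matrix.vecMul (fun _ => 1) A = fun _ => 1 := by
  obtain ⟨x, hx⟩ := h
  have hx1 : x = fun _ => 1 := funext fun i => (congrFun hx (Sum.inl i)).symm
  subst hx1
  exact funext fun j => (congrFun hx (Sum.inr j)).symm

theorem transpose_mem_translate_prodCode {F : Type*} [Field F] {k r l s : ℕ}
    {A : Matrix (Fin k) (Fin r) F} {B : Matrix (Fin l) (Fin s) F}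
    {a : Fin r → F} {b : Fin s → F} {N : Matrix (Fin l ⊕ Fin s) (Fin k ⊕ Fin r) F}
    (hN : N ∈ (fun N => N + consIU a b) '' prodCode A B) :
    Nᵀ ∈ (fun N => N + consIU b a) '' prodCode B A := by
  obtain ⟨_, ⟨M, rfl⟩, rfl⟩ := hN
  refine ⟨_, ⟨Mᵀ, rfl⟩, ?_⟩
  simp [consIU, Matrix.fromBlocks_transpose, Matrix.transpose_vecMulVec, Matrix.transpose_mul,
    Matrix.mul_assoc, add_comm]

theorem row_of_mem_translate_prodCode {F : Type*} [Field F] {k r l s : ℕ}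
    {A : Matrix (Fin k) (Fin r) F} {B : Matrix (Fin l) (Fin s) F}
    (hA : (fun _ => (1 : F)) ∈ sysCode A)
    {a : Fin r → F} {b : Fin s → F} {N : Matrix (Fin l ⊕ Fin s) (Fin k ⊕ Fin r) F}
    (hN : N ∈ (fun N => N + consIU a b) '' prodCode A B) (i : Fin l ⊕ Fin s) :
    ∃ c ∈ sysCode A, N i = c + Sum.elim (0 : Fin k → F) a := by
  obtain ⟨_, ⟨M, rfl⟩, rfl⟩ := hN
  have h1 := one_vecMul_of_one_mem_sysCode hA
  rcases i with i | i
  · refine ⟨_, ⟨M i, rfl⟩, ?_⟩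
    ext (j | j)
    · simp [consIU]
    · simp [consIU, Matrix.vecMulVec_apply, Matrix.mul_apply, Matrix.vecMul, dotProduct]
  · refine ⟨_, ⟨(Bᵀ * M) i + b i • (fun _ => 1), rfl⟩, ?_⟩
    rw [Matrix.add_vecMul, Matrix.smul_vecMul, h1]
    ext (j | j)
    · simp [consIU, Matrix.vecMulVec_apply]
    · simp [consIU, Matrix.vecMulVec_apply, Matrix.mul_apply, Matrix.vecMul, dotProduct,
        add_assoc]

theorem hammingNorm_add_hammingNorm_add_one {ι : Type*} [Fintype ι] (c : ι → ZMod 2) :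
    hammingNorm c + hammingNorm (c + fun _ => 1) = Fintype.card ι := by
  have h : ∀ x : ZMod 2, x + 1 ≠ 0 ↔ ¬ x ≠ 0 := by decide
  simp only [hammingNorm, Pi.add_apply, h]
  exact Finset.card_filter_add_card_filter_not _

theorem mem_and_hammingNorm_bounds_of_mem_coset {k r d : ℕ} {A : Matrix (Fin k) (Fin r) (ZMod 2)}
    {C : Submodule (ZMod 2) ((Fin k ⊕ Fin r) → ZMod 2)}
    (hd : ∀ c ∈ C, c ≠ 0 → d ≤ hammingNorm c)
    (hA : (fun _ => (1 : ZMod 2)) ∈ sysCode A)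
    (hsub : sysCode A ⊆ (C : Set ((Fin k ⊕ Fin r) → ZMod 2)))
    {u : (Fin k ⊕ Fin r) → ZMod 2} (hu : u ∈ (C : Set _) \ sysCode A)
    {c : (Fin k ⊕ Fin r) → ZMod 2} (hc : c ∈ sysCode A) :
    c + u ∈ C ∧ d ≤ hammingNorm (c + u) ∧ hammingNorm (c + u) ≤ (k + r) - d := by
  have hmem : c + u ∈ C := C.add_mem (hsub hc) hu.1
  have hone : (c + u) + (fun _ => 1) ∈ C := C.add_mem hmem (hsub hA)
  have h0 : c + u ≠ 0 := fun h => hu.2 <| by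
    have huc : u = c := funext fun i => (CharTwo.add_eq_zero.mp (congrFun h i)).symm
    rwa [huc]
  have h1 : (c + u) + (fun _ => 1) ≠ 0 := fun h => hu.2 <| by
    obtain ⟨x, rfl⟩ := hc
    have hu' : u = Sum.elim x (x ᵥ* A) + fun _ => 1 :=
      funext fun i => (by decide : ∀ y z : ZMod 2, y + z + 1 = 0 → z = y + 1) _ _ (congrFun h i)
    refine ⟨x + fun _ => 1, ?_⟩
    rw [hu', Matrix.add_vecMul, one_vecMul_of_one_mem_sysCode hA]
    ext (j | j) <;> rfl
  have hsum := hammingNorm_add_hammingNorm_add_one (c + u)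
  rw [Fintype.card_sum, Fintype.card_fin, Fintype.card_fin] at hsum
  have := hd _ hone h1
  exact ⟨hmem, hd _ hmem h0, by omega⟩

theorem systematicOfDim_translate_prodCode {F : Type*} [Field F] [Fintype F] {k r l s : ℕ}
    (A : Matrix (Fin k) (Fin r) F) (B : Matrix (Fin l) (Fin s) F)
    (a : Fin r → F) (b : Fin s → F) :
    SystematicOfDim ((fun N => N + consIU a b) '' prodCode A B) (k * l) := by
  refine ⟨?_, Finset.univ.map (Function.Embedding.inl.prodMap Function.Embedding.inl), ?_, ?_⟩
  · have hrange : prodCode A B = Set.range fun M : Matrix (Fin l) (Fin k) F =>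
        Matrix.fromBlocks M (M * A) (Bᵀ * M) (Bᵀ * M * A) := by
      ext N
      simp [prodCode, eq_comm]
    rw [Set.ncard_image_of_injective _ (add_left_injective _), hrange, ← Set.image_univ,
      Set.ncard_image_of_injective _ fun M M' h => (Matrix.fromBlocks_inj.mp h).1,
      Set.ncard_univ, Nat.card_eq_fintype_card]
    exact (Fintype.card_fun (α := Fin l) (β := Fin k → F)).trans <| by simp [← pow_mul]
  · simp [mul_comm]
  · intro f
    refine ⟨_, ⟨_, ⟨Matrix.of fun i j => f (Sum.inl i, Sum.inl j), rfl⟩, rfl⟩, ?_⟩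
    simp [consIU]

/-- Proposition 4.3: let `C` be a binary `[n, k, d_C]` code with
`⟨j_n⟩ ⊊ C` and `D` a binary `[m, l, d_D]` code with `⟨j_m⟩ ⊊ D`.  Here the subcode
`C′ ⊆ C` of dimension `k - 1` containing `⟨j_n⟩` is `sysCode A` (with systematic
dimension `k'`, so `k = k' + 1` and `n = k' + r`), `u = (0, a) ∈ C \ C′`, and similarly
`D′ = sysCode B`, `v = (0, b) ∈ D \ D′`.  Every matrix `N` in the affine product code
`(C′+u) ⊗ (D′+v) = (C′ ⊗ D′) + U` of Construction I has all row weights in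
`[d_C, n - d_C]` and all column weights in `[d_D, m - d_D]`; moreover the code is a
subset of the product code `C ⊗ D` (equivalently, all rows lie in `C` and all columns
lie in `D`) and is systematic of dimension `(k-1)(l-1) = k'l'`. -/
theorem stmt9 {k' r l' s dC dD : ℕ}
    (A : Matrix (Fin k') (Fin r) (ZMod 2)) (B : Matrix (Fin l') (Fin s) (ZMod 2))
    (C : Submodule (ZMod 2) ((Fin k' ⊕ Fin r) → ZMod 2))
    (D : Submodule (ZMod 2) ((Fin l' ⊕ Fin s) → ZMod 2))
    (hrankC : Module.finrank (ZMod 2) C = k' + 1)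
    (hrankD : Module.finrank (ZMod 2) D = l' + 1)
    (hdC : ∀ c ∈ C, c ≠ 0 → dC ≤ hammingNorm c)
    (hdC' : ∃ c ∈ C, c ≠ 0 ∧ hammingNorm c = dC)
    (hdD : ∀ c ∈ D, c ≠ 0 → dD ≤ hammingNorm c)
    (hdD' : ∃ c ∈ D, c ≠ 0 ∧ hammingNorm c = dD)
    (hjC : Submodule.span (ZMod 2) {(fun _ => 1 : (Fin k' ⊕ Fin r) → ZMod 2)} < C)
    (hjD : Submodule.span (ZMod 2) {(fun _ => 1 : (Fin l' ⊕ Fin s) → ZMod 2)} < D)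
    (hjC' : (fun _ => (1 : ZMod 2)) ∈ sysCode A)
    (hjD' : (fun _ => (1 : ZMod 2)) ∈ sysCode B)
    (hCsub : sysCode A ⊆ (C : Set ((Fin k' ⊕ Fin r) → ZMod 2)))
    (hDsub : sysCode B ⊆ (D : Set ((Fin l' ⊕ Fin s) → ZMod 2)))
    (a : Fin r → ZMod 2) (ha : Sum.elim (0 : Fin k' → ZMod 2) a ∈ (C : Set _) \ sysCode A)
    (b : Fin s → ZMod 2) (hb : Sum.elim (0 : Fin l' → ZMod 2) b ∈ (D : Set _) \ sysCode B) :
    (∀ N ∈ (fun N => N + consIU a b) '' prodCode A B,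
        (∀ i, dC ≤ hammingNorm (N i) ∧ hammingNorm (N i) ≤ (k' + r) - dC)
        ∧ (∀ j, dD ≤ hammingNorm (fun i => N i j)
            ∧ hammingNorm (fun i => N i j) ≤ (l' + s) - dD))
    ∧ (∀ N ∈ (fun N => N + consIU a b) '' prodCode A B,
        (∀ i, N i ∈ C) ∧ (∀ j, (fun i => N i j) ∈ D))
    ∧ SystematicOfDim ((fun N => N + consIU a b) '' prodCode A B) (k' * l') := by
  have row := fun N (hN : N ∈ (fun N => N + consIU a b) '' prodCode A B) i =>
    show N i ∈ C ∧ dC ≤ hammingNorm (N i) ∧ hammingNorm (N i) ≤ (k' + r) - dC by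
      obtain ⟨c, hc, h⟩ := row_of_mem_translate_prodCode hjC' hN i
      rw [h]
      exact mem_and_hammingNorm_bounds_of_mem_coset hdC hjC' hCsub ha hc
  have col := fun N (hN : N ∈ (fun N => N + consIU a b) '' prodCode A B) j =>
    show Nᵀ j ∈ D ∧ dD ≤ hammingNorm (Nᵀ j) ∧ hammingNorm (Nᵀ j) ≤ (l' + s) - dD by
      obtain ⟨c, hc, h⟩ :=
        row_of_mem_translate_prodCode hjD' (transpose_mem_translate_prodCode hN) j
      rw [h]
      exact mem_and_hammingNorm_bounds_of_mem_coset hdD hjD' hDsub hb hc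
  exact ⟨fun N hN => ⟨fun i => (row N hN i).2, fun j => (col N hN j).2⟩,
    fun N hN => ⟨fun i => (row N hN i).1, fun j => (col N hN j).1⟩,
    systematicOfDim_translate_prodCode A B a b⟩
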